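/- arXiv:0903.1684 — 5 statements merged into one kernel-verified Lean document; each statement's English description precedes it below -/
import Mathlib

section
/- Let λc > 0, R_I > 0 and β ∈ (0,1). Define U : (0,∞) → ℝ by U(r) = λc / (4·max{R_I², r²} − β²·r²) (note that the denominator is positive for every r > 0 since β < 1). Then U attains its maximum over (0,∞) uniquely at r = R_I: for every r > 0 with r ≠ R_I one has U(r) < U(R_I) = λc / ((4 − β²)·R_I²). -/
open Real

/-- Theorem 5: the upper bound `U r = λc / (4·max{R_I², r²} − β²·r²)` on the critical
density of primary transmitters is uniquely maximized at `r = R_I`, where it equals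
`λc / ((4 − β²)·R_I²)`. -/
theorem optimal_interference_range (lamc R_I beta : ℝ) (hlamc : 0 < lamc) (hRI : 0 < R_I)
    (hbeta0 : 0 < beta) (hbeta1 : beta < 1)
    (U : ℝ → ℝ)
    (hU : ∀ r, U r = lamc / (4 * max (R_I ^ 2) (r ^ 2) - beta ^ 2 * r ^ 2)) :
    U R_I = lamc / ((4 - beta ^ 2) * R_I ^ 2) ∧
      ∀ r : ℝ, 0 < r → r ≠ R_I → U r < U R_I := by
  have hval : U R_I = lamc / ((4 - beta ^ 2) * R_I ^ 2) := by
    rw [hU, max_self]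
    ring_nf
  refine ⟨hval, fun r hr hne => ?_⟩
  have hb : 0 < beta ^ 2 := by positivity
  have hb4 : 0 < 4 - beta ^ 2 := by nlinarith
  rw [hval, hU]
  refine div_lt_div_of_pos_left hlamc (by positivity) ?_
  rcases hne.lt_or_gt with h | h
  · have hsq : r ^ 2 < R_I ^ 2 := by gcongr
    rw [max_eq_left hsq.le]
    linarith [mul_lt_mul_of_pos_left hsq hb]
  · have hsq : R_I ^ 2 < r ^ 2 := by gcongr
    rw [max_eq_right hsq.le]
    linarith [mul_lt_mul_of_pos_left hsq hb4]
end

section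
/- Let λ_S > 0, λ_PT > 0, r_I > 0 and 0 < r_p ≤ r_I. Then λ_S·π·r_p² · ∫₀^{r_p} (2t/r_p²) · exp( −λ_PT·( π·r_I² − 2·r_I²·arccos(t/(2r_I)) + t·√(r_I² − t²/4) ) ) dt ≤ 2·λ_S·π / (λ_PT²·r_I²). -/
open Real MeasureTheory intervalIntegral

theorem mul_le_area_disk_sdiff_disk {r t : ℝ} (hr : 0 < r) (ht0 : 0 ≤ t) (htr : t ≤ r) :
    r * t ≤ π * r ^ 2 - 2 * r ^ 2 * Real.arccos (t / (2 * r))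
      + t * Real.sqrt (r ^ 2 - t ^ 2 / 4) := by
  have hx0 : 0 ≤ t / (2 * r) := by positivity
  have hx1 : t / (2 * r) ≤ 1 := by
    rw [div_le_one (by positivity)]
    linarith
  have h : t / (2 * r) ≤ Real.arcsin (t / (2 * r)) := by
    simpa [Real.sin_arcsin (by linarith) hx1] using Real.sin_le (Real.arcsin_nonneg.2 hx0)
  have hmul : 2 * r ^ 2 * (t / (2 * r)) ≤ 2 * r ^ 2 * Real.arcsin (t / (2 * r)) := by gcongr
  have heq : 2 * r ^ 2 * (t / (2 * r)) = r * t := by field_simp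
  have hsqrt : 0 ≤ t * Real.sqrt (r ^ 2 - t ^ 2 / 4) := by positivity
  rw [Real.arccos_eq_pi_div_two_sub_arcsin]
  linarith

theorem integral_mul_exp_neg_mul_le {a b : ℝ} (ha : 0 < a) (hb : 0 ≤ b) :
    ∫ t in (0:ℝ)..b, t * Real.exp (-(a * t)) ≤ 1 / a ^ 2 := by
  have hderiv : ∀ t ∈ Set.uIcc 0 b,
      HasDerivAt (fun t ↦ -(t / a + 1 / a ^ 2) * Real.exp (-(a * t)))
        (t * Real.exp (-(a * t))) t := by
    intro t _
    have h1 : HasDerivAt (fun t : ℝ ↦ -(t / a + 1 / a ^ 2)) (-(1 / a)) t :=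
      (((hasDerivAt_id t).div_const a).add_const _).neg
    have h2 : HasDerivAt (fun t : ℝ ↦ -(a * t)) (-(a * 1)) t :=
      ((hasDerivAt_id t).const_mul a).neg
    refine (h1.mul h2.exp).congr_deriv ?_
    field_simp
    ring
  rw [integral_eq_sub_of_hasDerivAt hderiv
    (Continuous.intervalIntegrable (by fun_prop) _ _)]
  have h : 0 ≤ (b / a + 1 / a ^ 2) * Real.exp (-(a * b)) := by positivity
  simp only [mul_zero, neg_zero, Real.exp_zero, zero_div, zero_add, mul_one]
  linarith

/-- Corollary 3 / Appendix B: the conditional average degree of a secondary user (in the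
regime `r_I ≥ R_p + R_I`) is bounded by `2·λ_S·π / (λ_PT²·r_I²)`. -/
theorem cond_avg_degree_upper_bound (lamS lamPT r_I r_p : ℝ)
    (hlamS : 0 < lamS) (hlamPT : 0 < lamPT) (hrI : 0 < r_I)
    (hrp0 : 0 < r_p) (hrp : r_p ≤ r_I) :
    lamS * π * r_p ^ 2 *
        ∫ t in (0:ℝ)..r_p,
          (2 * t / r_p ^ 2) *
            Real.exp (-lamPT * (π * r_I ^ 2 - 2 * r_I ^ 2 * Real.arccos (t / (2 * r_I))
              + t * Real.sqrt (r_I ^ 2 - t ^ 2 / 4)))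
      ≤ 2 * lamS * π / (lamPT ^ 2 * r_I ^ 2) := by
  have hle : ∫ t in (0:ℝ)..r_p,
      (2 * t / r_p ^ 2) *
        Real.exp (-lamPT * (π * r_I ^ 2 - 2 * r_I ^ 2 * Real.arccos (t / (2 * r_I))
          + t * Real.sqrt (r_I ^ 2 - t ^ 2 / 4)))
      ≤ ∫ t in (0:ℝ)..r_p, 2 / r_p ^ 2 * (t * Real.exp (-(lamPT * r_I * t))) := by
    refine integral_mono_on hrp0.le (Continuous.intervalIntegrable (by fun_prop) _ _)
      (Continuous.intervalIntegrable (by fun_prop) _ _) fun t ht ↦ ?_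
    have hexp := mul_le_mul_of_nonneg_left
      (mul_le_area_disk_sdiff_disk hrI ht.1 (ht.2.trans hrp)) hlamPT.le
    have ht0 := ht.1
    calc _ ≤ (2 * t / r_p ^ 2) * Real.exp (-(lamPT * r_I * t)) := by
          gcongr
          linarith
      _ = _ := by ring
  rw [intervalIntegral.integral_const_mul] at hle
  have hbound := integral_mul_exp_neg_mul_le (mul_pos hlamPT hrI) hrp0.le
  calc _ ≤ lamS * π * r_p ^ 2 * (2 / r_p ^ 2 * (1 / (lamPT * r_I) ^ 2)) := by
        gcongr
        exact hle.trans (by gcongr)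
    _ = _ := by field_simp
end

section
/- For all real numbers r_I > 0 and t with 0 ≤ t ≤ 2·r_I, one has π·r_I² − 2·r_I²·arccos(t/(2r_I)) + t·√(r_I² − t²/4) ≥ t·r_I. -/
open Real

/-- The linear bound `arccos x ≤ π / 2 - x` on `[0, 1]`. -/
theorem arccos_le_pi_div_two_sub {x : ℝ} (hx0 : 0 ≤ x) (hx1 : x ≤ 1) :
    Real.arccos x ≤ π / 2 - x := by
  have h := Real.sin_le (Real.arcsin_nonneg.2 hx0)
  rw [Real.sin_arcsin (by linarith) hx1] at h
  rw [Real.arccos_eq_pi_div_two_sub_arcsin]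
  linarith

/-- Appendix B key inequality: `π·r_I² − S_I(t,r_I,r_I) ≥ t·r_I` for `0 ≤ t ≤ 2·r_I`,
where `S_I(t,r_I,r_I) = 2r_I²·arccos(t/(2r_I)) − t·√(r_I² − t²/4)`. -/
theorem vacant_area_lower_bound (r_I t : ℝ) (hrI : 0 < r_I) (ht0 : 0 ≤ t) (ht : t ≤ 2 * r_I) :
    π * r_I ^ 2 - 2 * r_I ^ 2 * Real.arccos (t / (2 * r_I))
      + t * Real.sqrt (r_I ^ 2 - t ^ 2 / 4) ≥ t * r_I := by
  have hx1 : t / (2 * r_I) ≤ 1 := (div_le_one (by positivity)).2 ht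
  have harccos := mul_le_mul_of_nonneg_left
    (arccos_le_pi_div_two_sub (by positivity) hx1) (by positivity : 0 ≤ 2 * r_I ^ 2)
  have hlin : 2 * r_I ^ 2 * (π / 2 - t / (2 * r_I)) = π * r_I ^ 2 - t * r_I := by
    field_simp
  have hsqrt := mul_nonneg ht0 (Real.sqrt_nonneg (r_I ^ 2 - t ^ 2 / 4))
  linarith
end

section
/- Work in the Euclidean plane EuclideanSpace ℝ (Fin 2) with Lebesgue measure (volume). Let r > 0 and 0 ≤ t ≤ 2r, and let x_t denote the point with coordinates (t, 0). Then (volume (Metric.ball 0 r ∩ Metric.ball x_t r)).toReal = 2·r²·arccos(t/(2r)) − t·√(r² − t²/4). -/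
open Real MeasureTheory Metric

lemma hasDerivAt_sqrt_sq_sub_sq_primitive {r v : ℝ} (hr : 0 < r) (hv : v ^ 2 < r ^ 2) :
    HasDerivAt (fun y => y * √(r ^ 2 - y ^ 2) + r ^ 2 * arcsin (y / r))
      (2 * √(r ^ 2 - v ^ 2)) v := by
  have hpos : 0 < r ^ 2 - v ^ 2 := sub_pos.2 hv
  have habs := abs_lt.1 (abs_lt_of_sq_lt_sq hv hr.le)
  have hS : 0 < √(r ^ 2 - v ^ 2) := sqrt_pos.2 hpos
  have hsq : √(r ^ 2 - v ^ 2) ^ 2 = r ^ 2 - v ^ 2 := sq_sqrt hpos.le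
  have hsqrt : HasDerivAt (fun y => √(r ^ 2 - y ^ 2)) (-(2 * v) / (2 * √(r ^ 2 - v ^ 2))) v := by
    have := (((hasDerivAt_id v).pow 2).const_sub (r ^ 2)).sqrt hpos.ne'
    simpa using this
  have harcsin : HasDerivAt (fun y => arcsin (y / r)) (1 / √(1 - (v / r) ^ 2) * (1 / r)) v := by
    refine (hasDerivAt_arcsin ?_ ?_).comp v ((hasDerivAt_id v).div_const r)
    · exact ((lt_div_iff₀ hr).2 (by linarith [habs.1])).ne'
    · exact ((div_lt_one hr).2 habs.2).ne
  have hroot : √(1 - (v / r) ^ 2) = √(r ^ 2 - v ^ 2) / r := by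
    rw [show 1 - (v / r) ^ 2 = (r ^ 2 - v ^ 2) / r ^ 2 by field_simp, sqrt_div hpos.le,
      sqrt_sq hr.le]
  rw [hroot] at harcsin
  refine (((hasDerivAt_id v).mul hsqrt).add (harcsin.const_mul (r ^ 2))).congr_deriv ?_
  simp only [id]
  field_simp
  linarith

lemma integral_two_mul_sqrt_sq_sub_sq_sub_const {r h : ℝ} (hr : 0 < r) (hh : 0 ≤ h) (hhr : h ≤ r)
    (t : ℝ) :
    ∫ v in -h..h, (2 * √(r ^ 2 - v ^ 2) - t)
      = 2 * (h * √(r ^ 2 - h ^ 2) + r ^ 2 * arcsin (h / r)) - 2 * h * t := by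
  rw [intervalIntegral.integral_eq_sub_of_hasDerivAt_of_le
    (f := fun y => y * √(r ^ 2 - y ^ 2) + r ^ 2 * arcsin (y / r) - y * t) (by linarith)]
  · simp only [neg_div, arcsin_neg, neg_sq]
    ring
  · exact (((continuous_id.mul (by fun_prop)).add
      (continuous_const.mul (continuous_arcsin.comp (by fun_prop)))).sub
      (by fun_prop)).continuousOn
  · intro v hv
    have hvr : v ^ 2 < r ^ 2 := by nlinarith [hv.1, hv.2]
    exact ((hasDerivAt_sqrt_sq_sub_sq_primitive hr hvr).sub
      ((hasDerivAt_id v).mul_const t)).congr_deriv (by ring)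
  · exact Continuous.intervalIntegrable (by fun_prop) _ _

lemma mem_lens_iff {r t u v : ℝ} (ht0 : 0 ≤ t) :
    (u ^ 2 + v ^ 2 < r ^ 2 ∧ (u - t) ^ 2 + v ^ 2 < r ^ 2) ↔
      v ∈ Set.Ioo (-√(r ^ 2 - t ^ 2 / 4)) √(r ^ 2 - t ^ 2 / 4) ∧
        u ∈ Set.Ioo (t - √(r ^ 2 - v ^ 2)) √(r ^ 2 - v ^ 2) := by
  simp only [Set.mem_Ioo]
  rw [← abs_lt, lt_sqrt (abs_nonneg v), sq_abs]
  constructor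
  · rintro ⟨h1, h2⟩
    have hu := abs_lt.1 ((lt_sqrt (abs_nonneg u)).2
      (show |u| ^ 2 < r ^ 2 - v ^ 2 by rw [sq_abs]; linarith))
    have hut := abs_lt.1 ((lt_sqrt (abs_nonneg (u - t))).2
      (show |u - t| ^ 2 < r ^ 2 - v ^ 2 by rw [sq_abs]; linarith))
    exact ⟨by nlinarith [sq_nonneg (2 * u - t)], by linarith, hu.2⟩
  · rintro ⟨hv, h1, h2⟩
    have hsq : √(r ^ 2 - v ^ 2) ^ 2 = r ^ 2 - v ^ 2 := sq_sqrt (by nlinarith)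
    have hu := sq_lt_sq' (show -√(r ^ 2 - v ^ 2) < u by linarith) h2
    have hut := sq_lt_sq' (show -√(r ^ 2 - v ^ 2) < u - t by linarith) (by linarith)
    constructor <;> linarith

lemma measurePreserving_euclidean_swap :
    MeasurePreserving (fun p : EuclideanSpace ℝ (Fin 2) => (p 1, p 0)) volume
      (volume : Measure (ℝ × ℝ)) :=
  Measure.measurePreserving_swap.comp
    ((volume_preserving_finTwoArrow ℝ).comp (PiLp.volume_preserving_ofLp (Fin 2)))

lemma ball_inter_ball_eq_preimage_regionBetween {r t : ℝ} (hr : 0 < r) (ht0 : 0 ≤ t) :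
    ball (0 : EuclideanSpace ℝ (Fin 2)) r ∩ ball ((EuclideanSpace.equiv (Fin 2) ℝ).symm ![t, 0]) r
      = (fun p : EuclideanSpace ℝ (Fin 2) => (p 1, p 0)) ⁻¹'
        regionBetween (fun v => t - √(r ^ 2 - v ^ 2)) (fun v => √(r ^ 2 - v ^ 2))
          (Set.Ioo (-√(r ^ 2 - t ^ 2 / 4)) √(r ^ 2 - t ^ 2 / 4)) := by
  ext p
  simp only [Set.mem_inter_iff, mem_ball, EuclideanSpace.dist_eq, Fin.sum_univ_two,
    sqrt_lt' hr, Real.dist_eq, sq_abs, regionBetween, Set.mem_preimage, Set.mem_ofPred_eq]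
  rw [← mem_lens_iff ht0]
  simp

/-- The lens area formula: the common area of two disks of equal radius `r` whose centers
are a distance `t` apart (`0 ≤ t ≤ 2r`) equals `2·r²·arccos(t/(2r)) − t·√(r² − t²/4)`. -/
theorem lens_area (r t : ℝ) (hr : 0 < r) (ht0 : 0 ≤ t) (ht : t ≤ 2 * r)
    (x : EuclideanSpace ℝ (Fin 2))
    (hx : x = (EuclideanSpace.equiv (Fin 2) ℝ).symm ![t, 0]) :
    (volume (ball (0 : EuclideanSpace ℝ (Fin 2)) r ∩ ball x r)).toReal
      = 2 * r ^ 2 * Real.arccos (t / (2 * r)) - t * Real.sqrt (r ^ 2 - t ^ 2 / 4) := by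
  have hnonneg : 0 ≤ r ^ 2 - t ^ 2 / 4 := by nlinarith
  have hsq := sq_sqrt hnonneg
  have hpre := ball_inter_ball_eq_preimage_regionBetween hr ht0
  have harccos : arcsin (√(r ^ 2 - t ^ 2 / 4) / r) = arccos (t / (2 * r)) := by
    rw [arccos_eq_arcsin (by positivity),
      show 1 - (t / (2 * r)) ^ 2 = (r ^ 2 - t ^ 2 / 4) / r ^ 2 by field_simp; ring,
      sqrt_div hnonneg, sqrt_sq hr.le]
  set h := √(r ^ 2 - t ^ 2 / 4)
  have hh : 0 ≤ h := sqrt_nonneg _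
  have hhr : h ≤ r := by nlinarith [sq_nonneg t]
  have hroot : √(r ^ 2 - h ^ 2) = t / 2 := by
    rw [hsq, show r ^ 2 - (r ^ 2 - t ^ 2 / 4) = (t / 2) ^ 2 by ring, sqrt_sq (by positivity)]
  have hint : ∀ f : ℝ → ℝ, Continuous f → IntegrableOn f (Set.Ioo (-h) h) := fun f hf =>
    (hf.integrableOn_Icc (a := -h) (b := h)).mono_set Set.Ioo_subset_Icc_self
  have hle : ∀ v ∈ Set.Ioo (-h) h, t - √(r ^ 2 - v ^ 2) ≤ √(r ^ 2 - v ^ 2) := fun v hv => by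
    have : t / 2 ≤ √(r ^ 2 - v ^ 2) := le_sqrt_of_sq_le (by nlinarith [hv.1, hv.2])
    linarith
  have hlower : Continuous fun v : ℝ => t - √(r ^ 2 - v ^ 2) := by fun_prop
  have hupper : Continuous fun v : ℝ => √(r ^ 2 - v ^ 2) := by fun_prop
  rw [hx, hpre, measurePreserving_euclidean_swap.measure_preimage
    (measurableSet_regionBetween hlower.measurable hupper.measurable
      measurableSet_Ioo).nullMeasurableSet, Measure.volume_eq_prod,
    volume_regionBetween_eq_integral (hint _ hlower) (hint _ hupper) measurableSet_Ioo hle]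
  simp only [Pi.sub_apply]
  rw [ENNReal.toReal_ofReal
      (setIntegral_nonneg measurableSet_Ioo fun v hv => sub_nonneg.2 (hle v hv)),
    ← integral_Ioc_eq_integral_Ioo, ← intervalIntegral.integral_of_le (by linarith)]
  calc _ = ∫ v in -h..h, (2 * √(r ^ 2 - v ^ 2) - t) := by
        congr 1
        ext v
        ring
    _ = _ := by
        rw [integral_two_mul_sqrt_sq_sub_sq_sub_const hr hh hhr, hroot, harccos]
        ring
end

section
/- Work in the Euclidean plane EuclideanSpace ℝ (Fin 2). Let r_I > 0 and let A, B be two points with dist(A,B) ≤ 2·r_I. If P is a point with dist(P,A) ≥ r_I and dist(P,B) ≥ r_I, then for every point Q on the segment joining A and B (Q ∈ segment ℝ A B) one has dist(P,Q) ≥ √( r_I² − (dist(A,B))²/4 ). -/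
open Real Metric

/-- Stewart's identity in vector form. -/
theorem norm_smul_add_smul_sq_of_add_eq_one {E : Type*} [NormedAddCommGroup E]
    [InnerProductSpace ℝ E] {a b : ℝ} (hab : a + b = 1) (x y : E) :
    ‖a • x + b • y‖ ^ 2 = a * ‖x‖ ^ 2 + b * ‖y‖ ^ 2 - a * b * ‖x - y‖ ^ 2 := by
  obtain rfl : b = 1 - a := by linarith
  rw [norm_add_sq_real, norm_sub_sq_real, norm_smul, norm_smul, mul_pow, mul_pow,
    Real.norm_eq_abs, Real.norm_eq_abs, sq_abs, sq_abs, real_inner_smul_left,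
    real_inner_smul_right]
  ring

/-- Geometric step in the proof of Theorem 2.2: if `P` lies outside both disks of radius
`r_I` centered at `A` and `B` (with `dist A B ≤ 2·r_I`), then the distance from `P` to any
point of the segment joining `A` and `B` is at least `√(r_I² − dist(A,B)²/4)`. -/
theorem dist_to_segment_ge (r_I : ℝ) (hrI : 0 < r_I)
    (A B P Q : EuclideanSpace ℝ (Fin 2))
    (hAB : dist A B ≤ 2 * r_I)
    (hPA : r_I ≤ dist P A) (hPB : r_I ≤ dist P B)
    (hQ : Q ∈ segment ℝ A B) :
    Real.sqrt (r_I ^ 2 - (dist A B) ^ 2 / 4) ≤ dist P Q := by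
  obtain ⟨a, b, ha, hb, hab, rfl⟩ := hQ
  have stewart : dist P (a • A + b • B) ^ 2 =
      a * dist P A ^ 2 + b * dist P B ^ 2 - a * b * dist A B ^ 2 := by
    have hvec : P - (a • A + b • B) = a • (P - A) + b • (P - B) := by
      rw [smul_sub, smul_sub, sub_add_sub_comm, ← add_smul, hab, one_smul]
    rw [dist_comm A B, dist_eq_norm, dist_eq_norm, dist_eq_norm, dist_eq_norm, hvec,
      norm_smul_add_smul_sq_of_add_eq_one hab, sub_sub_sub_cancel_left]
  have hA : a * r_I ^ 2 ≤ a * dist P A ^ 2 := by gcongr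
  have hB : b * r_I ^ 2 ≤ b * dist P B ^ 2 := by gcongr
  have hprod : a * b * dist A B ^ 2 ≤ 1 / 4 * dist A B ^ 2 := by
    gcongr
    nlinarith [sq_nonneg (a - b)]
  have hr : a * r_I ^ 2 + b * r_I ^ 2 = r_I ^ 2 := by rw [← add_mul, hab, one_mul]
  exact Real.sqrt_le_iff.mpr ⟨dist_nonneg, by linarith⟩
end
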